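/- arXiv:1610.03381 — 7 statements merged into one kernel-verified Lean document; each statement's English description precedes it below -/
import Mathlib

section
/- A bounded uniformly continuous function vanishes at infinity as a measure if and only if it vanishes at infinity as a function: let G be a σ-compact locally compact abelian Hausdorff group with Haar measure θ and let f : G → ℂ be bounded and uniformly continuous. Then f ∈ C₀(G) if and only if for every g ∈ C_c(G) the convolution f∗g, defined by (f∗g)(x) = ∫_G f(x−t) g(t) dθ(t), belongs to C₀(G). -/
open MeasureTheory Filter Topology

theorem conv_diff_le
    {G : Type*} [TopologicalSpace G] [T2Space G]
    [MeasurableSpace G] [BorelSpace G]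
    (θ : Measure G) [IsFiniteMeasureOnCompacts θ]
    (h₁ h₂ g : G → ℂ) (c₁ : Continuous h₁) (c₂ : Continuous h₂) (hg : Continuous g)
    (hs : HasCompactSupport g) (ε : ℝ)
    (H : ∀ t, g t ≠ 0 → ‖h₁ t - h₂ t‖ ≤ ε) :
    ‖(∫ t, h₁ t * g t ∂θ) - ∫ t, h₂ t * g t ∂θ‖ ≤ ε * ∫ t, ‖g t‖ ∂θ := by
  have i₁ : Integrable (fun t => h₁ t * g t) θ :=
    (c₁.mul hg).integrable_of_hasCompactSupport hs.mul_left
  have i₂ : Integrable (fun t => h₂ t * g t) θ :=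
    (c₂.mul hg).integrable_of_hasCompactSupport hs.mul_left
  have i₃ : Integrable g θ := hg.integrable_of_hasCompactSupport hs
  rw [← integral_sub i₁ i₂, ← integral_const_mul]
  refine norm_integral_le_of_norm_le (i₃.norm.const_mul ε) (Eventually.of_forall fun t => ?_)
  rw [← sub_mul, norm_mul]
  by_cases h0 : g t = 0
  · simp [h0]
  · exact mul_le_mul_of_nonneg_right (H t h0) (norm_nonneg _)

/-- A bounded uniformly continuous function vanishes at infinity as a measure
iff it vanishes at infinity as a function: `f ∈ C₀(G)` iff `f ∗ g ∈ C₀(G)` for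
every `g ∈ C_c(G)`, where the convolution is taken with respect to a Haar
measure `θ`. -/
theorem c0_as_measure_iff_c0_as_function
    {G : Type*} [TopologicalSpace G] [AddCommGroup G] [IsTopologicalAddGroup G]
    [LocallyCompactSpace G] [SigmaCompactSpace G] [T2Space G]
    [MeasurableSpace G] [BorelSpace G]
    (θ : Measure G) [θ.IsAddHaarMeasure]
    (f : G → ℂ)
    (hb : ∃ C : ℝ, ∀ x, ‖f x‖ ≤ C)
    (huc : ∀ ε > (0 : ℝ), ∃ U ∈ 𝓝 (0 : G), ∀ x y : G, x - y ∈ U → ‖f x - f y‖ < ε) :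
    (Continuous f ∧ Tendsto f (cocompact G) (𝓝 0)) ↔
      (∀ g : G → ℂ, Continuous g → HasCompactSupport g →
        Continuous (fun x => ∫ t, f (x - t) * g t ∂θ) ∧
          Tendsto (fun x => ∫ t, f (x - t) * g t ∂θ) (cocompact G) (𝓝 0)) := by
  have hf : Continuous f := by
    rw [continuous_iff_continuousAt]
    intro x₀
    refine Metric.tendsto_nhds.2 fun ε hε => ?_
    obtain ⟨U, hU, h⟩ := huc ε hε
    have : Tendsto (fun x => x - x₀) (𝓝 x₀) (𝓝 0) :=
      (continuous_id.sub continuous_const).tendsto' _ _ (by simp)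
    filter_upwards [this hU] with x hx
    rw [dist_eq_norm]
    exact h x x₀ hx
  have hsub : ∀ x : G, Continuous (fun t => f (x - t)) := fun x =>
    hf.comp (continuous_const.sub continuous_id)
  constructor
  · rintro ⟨-, hlim⟩ g hg hs
    set M : ℝ := ∫ t, ‖g t‖ ∂θ with hM
    have hM0 : 0 ≤ M := integral_nonneg fun t => norm_nonneg _
    have key : ∀ ε > 0, ε / (M + 1) * M < ε := by
      intro ε hε
      rw [div_mul_eq_mul_div, div_lt_iff₀ (by positivity)]
      nlinarith
    constructor
    · rw [continuous_iff_continuousAt]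
      intro x₀
      refine Metric.tendsto_nhds.2 fun ε hε => ?_
      obtain ⟨U, hU, h⟩ := huc (ε / (M + 1)) (by positivity)
      have : Tendsto (fun x => x - x₀) (𝓝 x₀) (𝓝 0) :=
        (continuous_id.sub continuous_const).tendsto' _ _ (by simp)
      filter_upwards [this hU] with x hx
      rw [dist_eq_norm]
      refine (conv_diff_le θ _ _ g (hsub x) (hsub x₀) hg hs (ε / (M + 1)) ?_).trans_lt (key ε hε)
      intro t _
      refine (h _ _ ?_).le
      rw [sub_sub_sub_cancel_right]
      exact hx
    · refine Metric.tendsto_nhds.2 fun ε hε => ?_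
      have h1 := Metric.tendsto_nhds.1 hlim (ε / (M + 1)) (by positivity)
      obtain ⟨L, hL, hL'⟩ := mem_cocompact.1 h1
      filter_upwards [(hL.add hs).compl_mem_cocompact] with x hx
      have := conv_diff_le θ _ (fun _ => 0) g (hsub x) continuous_const hg hs (ε / (M + 1)) ?_
      · rw [dist_eq_norm]
        simp only [zero_mul, integral_zero] at this
        exact this.trans_lt (key ε hε)
      · intro t ht
        have hxt : x - t ∈ Lᶜ := fun hmem => hx
          ⟨x - t, hmem, t, subset_tsupport g ht, sub_add_cancel x t⟩
        have := hL' hxt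
        simp only [Set.mem_ofPred_eq, dist_eq_norm] at this
        exact this.le
  · intro H
    refine ⟨hf, Metric.tendsto_nhds.2 fun ε hε => ?_⟩
    obtain ⟨U, hU, h⟩ := huc (ε / 2) (by positivity)
    obtain ⟨φ, hφ1, hφ0, hφs, hφI⟩ := exists_continuous_one_zero_of_isCompact
      (isCompact_singleton (x := (0 : G))) (isOpen_interior (s := U)).isClosed_compl
      (by simpa [Set.disjoint_left] using mem_interior_iff_mem_nhds.2 hU)
    have hm : 0 < ∫ t, φ t ∂θ :=
      φ.continuous.integral_pos_of_hasCompactSupport_nonneg_nonzero hφs (fun t => (hφI t).1)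
        (x := 0) (by rw [hφ1 rfl]; simp)
    set m : ℝ := ∫ t, φ t ∂θ with hmdef
    have hg : Continuous (fun t => (φ t : ℂ)) := Complex.continuous_ofReal.comp φ.continuous
    have hs : HasCompactSupport (fun t => (φ t : ℂ)) :=
      hφs.comp_left (g := fun r : ℝ => (r : ℂ)) Complex.ofReal_zero
    have hn : ∫ t, ‖(φ t : ℂ)‖ ∂θ = m := by
      rw [hmdef]
      congr 1
      ext t
      rw [Complex.norm_real, Real.norm_of_nonneg (hφI t).1]
    filter_upwards [Metric.tendsto_nhds.1 (H _ hg hs).2 (ε / 2 * m) (by positivity)] with x hx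
    have h2 := conv_diff_le θ _ (fun _ => f x) _ (hsub x) continuous_const hg hs (ε / 2) ?_
    · rw [hn, integral_const_mul, integral_complex_ofReal, norm_sub_rev] at h2
      rw [dist_zero_right] at hx ⊢
      have h3 := norm_le_norm_add_norm_sub' (f x * (m : ℂ)) (∫ t, f (x - t) * (φ t : ℂ) ∂θ)
      have h4 : ‖f x * (m : ℂ)‖ = ‖f x‖ * m := by
        rw [norm_mul, Complex.norm_real, Real.norm_of_nonneg hm.le]
      rw [h4] at h3
      have h5 : ‖f x‖ * m < ε * m := by
        refine h3.trans_lt ((add_lt_add_of_lt_of_le hx h2).trans_eq (by ring))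
      exact lt_of_mul_lt_mul_right h5 hm.le
    · intro t ht
      have htU : t ∈ U := by
        by_contra hc
        apply ht
        have : φ t = 0 := hφ0 (fun hi => hc (interior_subset hi))
        simp [this]
      rw [norm_sub_rev]
      refine (h _ _ ?_).le
      rwa [sub_sub_cancel]
end

section
/- Test functions from K₂(G) suffice to detect vanishing at infinity: let G be a σ-compact locally compact abelian Hausdorff group with Haar measure θ, and let μ be a positive regular Borel measure on G that is translation bounded (equivalently, μ∗f is bounded and uniformly continuous for every f ∈ C_c(G)). Then μ vanishes at infinity (i.e. μ∗f ∈ C₀(G) for every f ∈ C_c(G)) if and only if μ∗(f∗g) ∈ C₀(G) for all f, g ∈ C_c(G), where (f∗g)(x) = ∫_G f(x−t) g(t) dθ(t). -/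
open MeasureTheory Filter Topology
open scoped NNReal Pointwise

/-- The convolution of two continuous compactly supported functions has the same properties. -/
lemma conv_cont_compact {𝕜 G : Type*} [RCLike 𝕜] [TopologicalSpace G] [AddCommGroup G]
    [IsTopologicalAddGroup G] [T2Space G] [MeasurableSpace G] [BorelSpace G]
    (θ : Measure G) [IsFiniteMeasureOnCompacts θ] (hlf : IsLocallyFiniteMeasure θ)
    (f g : G → 𝕜) (hf : Continuous f) (hfc : HasCompactSupport f)
    (hg : Continuous g) (hgc : HasCompactSupport g) :
    Continuous (fun x => ∫ s, f (x - s) * g s ∂θ) ∧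
      HasCompactSupport (fun x => ∫ s, f (x - s) * g s ∂θ) := by
  have e : (fun x => ∫ s, f (x - s) * g s ∂θ) =
      convolution g f (ContinuousLinearMap.mul 𝕜 𝕜) θ := by
    funext x
    simp [convolution, mul_comm]
  rw [e]
  exact ⟨hfc.continuous_convolution_right _ hg.locallyIntegrable hf, hgc.convolution _ hfc⟩

/-- Convolving a locally finite measure with a test function gives a continuous function. -/
lemma meas_conv_cont {G : Type*} [TopologicalSpace G] [AddCommGroup G]
    [IsTopologicalAddGroup G] [T2Space G] [MeasurableSpace G] [BorelSpace G]
    (μ : Measure G) [IsLocallyFiniteMeasure μ]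
    (f : G → ℂ) (hf : Continuous f) (hfc : HasCompactSupport f) :
    Continuous (fun x => ∫ t, f (x - t) ∂μ) := by
  have e : (fun x => ∫ t, f (x - t) ∂μ) =
      convolution (fun _ => (1 : ℂ)) f (ContinuousLinearMap.mul ℂ ℂ) μ := by
    funext x
    simp [convolution]
  rw [e]
  exact hfc.continuous_convolution_right _ (continuous_const.locallyIntegrable) hf

lemma integrable_refl {E G : Type*} [NormedAddCommGroup E] [TopologicalSpace G] [AddCommGroup G]
    [IsTopologicalAddGroup G] [MeasurableSpace G] [BorelSpace G]
    (μ : Measure G) [IsFiniteMeasureOnCompacts μ]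
    (f : G → E) (hf : Continuous f) (hfc : HasCompactSupport f) (x : G) :
    Integrable (fun t => f (x - t)) μ :=
  (hf.comp (continuous_const.sub continuous_id)).integrable_of_hasCompactSupport
    (hfc.comp_homeomorph (Homeomorph.subLeft x))

/-- A compact set carries a convolution of nonnegative test functions bounded below on it. -/
lemma exists_conv_lower {G : Type*} [TopologicalSpace G] [AddCommGroup G]
    [IsTopologicalAddGroup G] [LocallyCompactSpace G] [T2Space G]
    [MeasurableSpace G] [BorelSpace G] (θ : Measure G) [θ.IsAddHaarMeasure]
    (K : Set G) (hK : IsCompact K) :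
    ∃ g h : G → ℝ, Continuous g ∧ HasCompactSupport g ∧ Continuous h ∧ HasCompactSupport h ∧
      (∀ x, 0 ≤ g x) ∧ (∀ x, 0 ≤ h x) ∧
      ∃ c : ℝ, 0 < c ∧ ∀ x ∈ K, c ≤ ∫ s, g (x - s) * h s ∂θ := by
  obtain ⟨V, hV, hV0⟩ := exists_compact_mem_nhds (0 : G)
  obtain ⟨h, h1, -, hc, h01⟩ := exists_continuous_one_zero_of_isCompact hV isClosed_empty
    (Set.disjoint_empty _)
  obtain ⟨g, g1, -, gc, g01⟩ := exists_continuous_one_zero_of_isCompact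
    ((hK.prod hV).image continuous_sub) isClosed_empty
    (Set.disjoint_empty _)
  refine ⟨g, h, g.continuous, gc, h.continuous, hc, fun x => (g01 x).1, fun x => (h01 x).1,
    θ.real V, ?_, fun x hx => ?_⟩
  · exact ENNReal.toReal_pos (Measure.measure_pos_of_mem_nhds θ hV0).ne' hV.measure_lt_top.ne
  · have hi : Integrable (fun s => g (x - s) * h s) θ := by
      apply Continuous.integrable_of_hasCompactSupport
      · exact (g.continuous.comp (continuous_const.sub continuous_id)).mul h.continuous
      · exact hc.mul_left
    calc θ.real V = ∫ s in V, (1 : ℝ) ∂θ := by simp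
      _ = ∫ s in V, g (x - s) * h s ∂θ := by
        apply setIntegral_congr_fun hV.measurableSet
        intro s hs
        have := g1 (Set.mem_image_of_mem (fun p : G × G => p.1 - p.2) (Set.mk_mem_prod hx hs))
        have h2 := h1 hs
        simp_all
      _ ≤ _ := setIntegral_le_integral hi
        (Eventually.of_forall fun s => mul_nonneg (g01 _).1 (h01 _).1)

/-- Test functions from `K₂(G)` suffice to detect vanishing at infinity: a
translation bounded positive regular measure `μ` satisfies `μ ∗ f ∈ C₀(G)` for
all `f ∈ C_c(G)` iff `μ ∗ (f ∗ g) ∈ C₀(G)` for all `f, g ∈ C_c(G)`, where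
`f ∗ g` is the convolution with respect to a Haar measure `θ`. -/
theorem vanishing_at_infinity_detected_by_K2
    {G : Type*} [TopologicalSpace G] [AddCommGroup G] [IsTopologicalAddGroup G]
    [LocallyCompactSpace G] [SigmaCompactSpace G] [T2Space G]
    [MeasurableSpace G] [BorelSpace G]
    (θ : Measure G) [θ.IsAddHaarMeasure]
    (μ : Measure G) [μ.Regular]
    (htb : ∀ K : Set G, IsCompact K → ∃ C : ℝ≥0, ∀ x : G, μ (x +ᵥ K) ≤ C) :
    (∀ f : G → ℂ, Continuous f → HasCompactSupport f →
        Continuous (fun x => ∫ t, f (x - t) ∂μ) ∧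
          Tendsto (fun x => ∫ t, f (x - t) ∂μ) (cocompact G) (𝓝 0)) ↔
      (∀ f g : G → ℂ, Continuous f → HasCompactSupport f →
          Continuous g → HasCompactSupport g →
        Continuous (fun x => ∫ t, (∫ s, f (x - t - s) * g s ∂θ) ∂μ) ∧
          Tendsto (fun x => ∫ t, (∫ s, f (x - t - s) * g s ∂θ) ∂μ)
            (cocompact G) (𝓝 0)) := by
  constructor
  · intro H f g hf hfc hg hgc
    obtain ⟨h1, h2⟩ := conv_cont_compact θ inferInstance f g hf hfc hg hgc
    exact H _ h1 h2
  · intro H f hf hfc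
    refine ⟨meas_conv_cont μ f hf hfc, ?_⟩
    obtain ⟨g, h, hg, hgc, hh, hhc, g0, h0, c, c0, hK⟩ := exists_conv_lower θ (tsupport f) hfc
    obtain ⟨hF, hFc⟩ := conv_cont_compact θ inferInstance g h hg hgc hh hhc
    obtain ⟨M, hM⟩ := hfc.exists_bound_of_continuous hf
    have hM0 : 0 ≤ M := (norm_nonneg _).trans (hM 0)
    have hF0 : ∀ x, 0 ≤ ∫ s, g (x - s) * h s ∂θ := fun x =>
      integral_nonneg fun s => mul_nonneg (g0 _) (h0 _)
    have hle : ∀ x, ‖f x‖ ≤ M / c * ∫ s, g (x - s) * h s ∂θ := by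
      intro x
      by_cases hx : x ∈ tsupport f
      · calc ‖f x‖ ≤ M := hM x
          _ = M / c * c := by field_simp
          _ ≤ _ := by gcongr; exact hK x hx
      · rw [image_eq_zero_of_notMem_tsupport hx, norm_zero]
        exact mul_nonneg (by positivity) (hF0 x)
    have T := (H (fun x => (g x : ℂ)) (fun x => (h x : ℂ)) (Complex.continuous_ofReal.comp hg)
      (hgc.comp_left Complex.ofReal_zero) (Complex.continuous_ofReal.comp hh)
      (hhc.comp_left Complex.ofReal_zero)).2
    have e : (fun x => ∫ t, (∫ s, (g (x - t - s) : ℂ) * (h s : ℂ) ∂θ) ∂μ) =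
        fun x => ((∫ t, (∫ s, g (x - t - s) * h s ∂θ) ∂μ : ℝ) : ℂ) := by
      funext x
      rw [← integral_complex_ofReal]
      congr 1
      funext t
      rw [← integral_complex_ofReal]
      simp
    rw [e] at T
    have T2 := (T.norm).const_mul (M / c)
    rw [norm_zero, mul_zero] at T2
    refine squeeze_zero_norm (fun x => ?_) T2
    calc ‖∫ t, f (x - t) ∂μ‖ ≤ ∫ t, M / c * ∫ s, g (x - t - s) * h s ∂θ ∂μ :=
          norm_integral_le_of_norm_le ((integrable_refl μ _ hF hFc x).const_mul _)
            (Eventually.of_forall fun t => hle _)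
      _ = M / c * ∫ t, ∫ s, g (x - t - s) * h s ∂θ ∂μ := integral_const_mul _ _
      _ ≤ _ := by
        rw [Complex.norm_real]
        gcongr
        exact le_abs_self _
end

section
/- Characterization of positive measures vanishing at infinity: let G be a σ-compact locally compact abelian Hausdorff group and let μ be a positive regular Borel measure on G that is finite on compact sets. Then μ∗f ∈ C₀(G) for every f ∈ C_c(G) if and only if for every compact set K ⊆ G the function x ↦ μ(x+K) tends to 0 along the cocompact filter (i.e., for every ε > 0 there is a compact set K_ε with μ(x+K) < ε for all x ∉ K_ε). -/
open MeasureTheory Filter Topology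
open scoped NNReal Pointwise

/-- Characterization of positive measures vanishing at infinity: a positive
regular measure `μ`, finite on compacts, satisfies `μ ∗ f ∈ C₀(G)` for every
`f ∈ C_c(G)` iff for every compact `K` the function `x ↦ μ (x + K)` tends to
`0` along the cocompact filter. -/
theorem positive_measure_vanishing_iff_translates_vanish
    {G : Type*} [TopologicalSpace G] [AddCommGroup G] [IsTopologicalAddGroup G]
    [LocallyCompactSpace G] [SigmaCompactSpace G] [T2Space G]
    [MeasurableSpace G] [BorelSpace G]
    (μ : Measure G) [μ.Regular] [IsFiniteMeasureOnCompacts μ] :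
    (∀ f : G → ℂ, Continuous f → HasCompactSupport f →
        Continuous (fun x => ∫ t, f (x - t) ∂μ) ∧
          Tendsto (fun x => ∫ t, f (x - t) ∂μ) (cocompact G) (𝓝 0)) ↔
      (∀ K : Set G, IsCompact K →
        Tendsto (fun x => μ (x +ᵥ K)) (cocompact G) (𝓝 0)) := by
  constructor
  · intro h K hK
    obtain ⟨f, hf1, -, hfc, hf01⟩ :=
      exists_continuous_one_zero_of_isCompact hK.neg isClosed_empty (Set.disjoint_empty (-K))
    have hlim := (h (fun x => (f x : ℂ)) (Complex.continuous_ofReal.comp f.continuous)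
      (hfc.comp_left (g := fun r : ℝ => (r : ℂ)) Complex.ofReal_zero)).2
    have hlim' : Tendsto (fun x => ∫ t, f (x - t) ∂μ) (cocompact G) (𝓝 0) := by
      have h2 := (Complex.continuous_re.tendsto 0).comp hlim
      refine Tendsto.congr (fun x => ?_) h2
      simp only [Function.comp]
      rw [integral_complex_ofReal, Complex.ofReal_re]
    have hlim2 := ENNReal.tendsto_ofReal hlim'
    rw [ENNReal.ofReal_zero] at hlim2
    refine tendsto_of_tendsto_of_tendsto_of_le_of_le tendsto_const_nhds hlim2
      (fun _ => zero_le) (fun x => ?_)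
    have hcont : Continuous (fun t => f (x - t)) := f.continuous.comp (continuous_const.sub continuous_id)
    have hsupp : HasCompactSupport (fun t => f (x - t)) :=
      hfc.comp_homeomorph (Homeomorph.subLeft x)
    have hint : Integrable (fun t => f (x - t)) μ := hcont.integrable_of_hasCompactSupport hsupp
    have hms : MeasurableSet (x +ᵥ K) := (hK.vadd x).measurableSet
    show μ (x +ᵥ K) ≤ ENNReal.ofReal (∫ t, f (x - t) ∂μ)
    rw [ofReal_integral_eq_lintegral_ofReal hint (Eventually.of_forall fun t => (hf01 _).1),
      ← lintegral_indicator_one hms]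
    refine lintegral_mono fun t => ?_
    by_cases ht : t ∈ x +ᵥ K
    · obtain ⟨k, hk, rfl⟩ := Set.mem_vadd_set.1 ht
      have : f (x - (x +ᵥ k)) = 1 := hf1 (by simpa using hk)
      rw [Set.indicator_of_mem ht, this]
      simp
    · simp [Set.indicator_of_notMem ht]
  · intro h f hf hfc
    have hb : ∃ C : ℝ, ∀ x, ‖f x‖ ≤ C := hfc.exists_bound_of_continuous hf
    obtain ⟨C, hC⟩ := hb
    have hC0 : 0 ≤ C := (norm_nonneg _).trans (hC 0)
    refine ⟨?_, ?_⟩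
    · have := hfc.continuous_convolution_right (μ := μ) (ContinuousLinearMap.lsmul ℝ ℝ)
        (f := fun _ : G => (1 : ℝ)) (locallyIntegrable_const _) hf
      convert this using 2 with x
      simp [MeasureTheory.convolution]
    · have hK : IsCompact (-(tsupport f)) := IsCompact.neg hfc
      have key : ∀ x, ‖∫ t, f (x - t) ∂μ‖ ≤ C * (μ (x +ᵥ (-(tsupport f)))).toReal := by
        intro x
        rw [← setIntegral_eq_integral_of_forall_compl_eq_zero (s := x +ᵥ (-(tsupport f)))]
        · exact norm_setIntegral_le_of_norm_le_const (hK.vadd x).measure_lt_top (fun t _ => hC _)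
        · intro t ht
          apply image_eq_zero_of_notMem_tsupport
          intro h'
          apply ht
          rw [Set.mem_vadd_set]
          exact ⟨t - x, by simpa using h', by simp⟩
      refine squeeze_zero_norm key ?_
      have := (ENNReal.tendsto_toReal ENNReal.zero_ne_top).comp (h _ hK)
      simpa using this.const_mul C
end

section
/- For measures with uniformly discrete support, vanishing at infinity is equivalent to coefficients vanishing at infinity: let G be a σ-compact locally compact abelian Hausdorff group, let Λ ⊆ G be uniformly discrete (there is an open neighborhood U of 0 such that (x+U) ∩ (y+U) = ∅ for all distinct x, y ∈ Λ), and let c : G → ℂ vanish outside Λ and satisfy the translation boundedness condition: for every compact K ⊆ G, sup_{x∈G} Σ_{s ∈ Λ ∩ (x+K)} |c(s)| < ∞. Then the following are equivalent: (a) for every f ∈ C_c(G), the function x ↦ Σ_{s∈Λ} c(s) f(x−s) belongs to C₀(G); (b) for every ε > 0 there is a compact set K_ε ⊆ G with |c(s)| < ε for all s ∈ Λ ∖ K_ε. -/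
open MeasureTheory Filter Topology
open scoped Pointwise

theorem ud_finite_aux {G : Type*} [TopologicalSpace G] [AddCommGroup G] [IsTopologicalAddGroup G]
    (Λ : Set G) (U : Set G) (hUopen : IsOpen U) (hU0 : (0 : G) ∈ U)
    (huniq : ∀ y, ∀ s ∈ Λ, ∀ t ∈ Λ, y - s ∈ U → y - t ∈ U → s = t)
    (K : Set G) (hK : IsCompact K) :
    ∃ N : ℕ, ∀ x : G, ∃ T : Finset G, T.card ≤ N ∧ ∀ s ∈ Λ, x - s ∈ K → s ∈ T := by
  classical
  obtain ⟨F, hF⟩ := hK.elim_finite_subcover (fun k : G => {z : G | z - k ∈ U})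
    (fun k => hUopen.preimage (by fun_prop : Continuous fun z : G => z - k))
    (fun z _ => Set.mem_iUnion.2 ⟨z, by simpa using hU0⟩)
  have hg : ∀ y : G, ∃ s : G, ∀ t ∈ Λ, y - t ∈ U → t = s := by
    intro y
    by_cases h : ∃ s ∈ Λ, y - s ∈ U
    · obtain ⟨s, hs, hys⟩ := h
      exact ⟨s, fun t ht hyt => huniq y t ht s hs hyt hys⟩
    · exact ⟨0, fun t ht hyt => absurd ⟨t, ht, hyt⟩ h⟩
  choose g hg using hg
  refine ⟨F.card, fun x => ⟨F.image (fun k => g (x - k)), Finset.card_image_le, ?_⟩⟩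
  intro s hs hxs
  obtain ⟨k, hk, hxk⟩ := Set.mem_iUnion₂.1 (hF hxs)
  refine Finset.mem_image.2 ⟨k, hk, (hg (x - k) s hs ?_).symm⟩
  have : x - k - s = x - s - k := by abel
  rw [this]; exact hxk

/-- For measures with uniformly discrete support, vanishing at infinity is
equivalent to the coefficients vanishing at infinity: for a translation
bounded weighted Dirac comb `Σ_{s ∈ Λ} c(s) δ_s` with `Λ` uniformly discrete,
all convolutions with `C_c(G)` functions lie in `C₀(G)` iff the coefficients
`c(s)` vanish at infinity. -/
theorem uniformly_discrete_vanishing_iff_coefficients_vanish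
    {G : Type*} [TopologicalSpace G] [AddCommGroup G] [IsTopologicalAddGroup G]
    [LocallyCompactSpace G] [SigmaCompactSpace G] [T2Space G]
    (Λ : Set G) (U : Set G) (hUopen : IsOpen U) (hU0 : (0 : G) ∈ U)
    (hΛ : ∀ x ∈ Λ, ∀ y ∈ Λ, x ≠ y → Disjoint (x +ᵥ U) (y +ᵥ U))
    (c : G → ℂ) (hc : ∀ x, x ∉ Λ → c x = 0)
    (htb : ∀ K : Set G, IsCompact K →
      ∃ C : ℝ, ∀ x : G, ∑' s : ↥(Λ ∩ (x +ᵥ K)), ‖c s‖ ≤ C) :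
    (∀ f : G → ℂ, Continuous f → HasCompactSupport f →
        Continuous (fun x => ∑' s : Λ, c s * f (x - s)) ∧
          Tendsto (fun x => ∑' s : Λ, c s * f (x - s)) (cocompact G) (𝓝 0)) ↔
      (∀ ε > (0 : ℝ), ∃ K : Set G, IsCompact K ∧ ∀ s ∈ Λ \ K, ‖c s‖ < ε) := by
  classical
  have huniq : ∀ y, ∀ s ∈ Λ, ∀ t ∈ Λ, y - s ∈ U → y - t ∈ U → s = t := by
    intro y s hs t ht h1 h2
    by_contra hne
    have hd := Set.disjoint_left.1 (hΛ s hs t ht hne)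
    refine @hd y ?_ ?_
    · exact ⟨y - s, h1, by simp⟩
    · exact ⟨y - t, h2, by simp⟩
  constructor
  · intro h ε hε
    obtain ⟨f, hf1, hf0, hfc, -⟩ := exists_continuous_one_zero_of_isCompact
      (isCompact_singleton (x := (0 : G))) hUopen.isClosed_compl
      (by simpa using hU0)
    have h1 := (h (fun x => (f x : ℂ)) (by fun_prop)
      (hfc.comp_left (g := fun r : ℝ => (r : ℂ)) (by simp))).2
    have h2 := h1.eventually (Metric.ball_mem_nhds (0 : ℂ) hε)
    obtain ⟨K, hK, hKs⟩ := mem_cocompact.1 h2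
    refine ⟨K, hK, fun s hs => ?_⟩
    have h3 := hKs hs.2
    have h4 : ∑' t : Λ, c t * (f (s - t) : ℂ) = c s := by
      rw [tsum_eq_single (⟨s, hs.1⟩ : Λ)]
      · have : f 0 = 1 := hf1 rfl
        simp [this]
      · intro t ht
        have : f (s - t) = 0 := by
          apply hf0
          intro hU
          exact ht (Subtype.ext (huniq s t t.2 s hs.1 hU (by simpa using hU0)))
        simp [this]
    have h5 : ∑' t : Λ, c t * (f (s - t) : ℂ) ∈ Metric.ball (0 : ℂ) ε := h3
    rw [h4] at h5
    simpa using h5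
  · intro h f hf hfc
    have hz : ∀ z, z ∉ tsupport f → f z = 0 := fun z hz => image_eq_zero_of_notMem_tsupport hz
    obtain ⟨N, hN⟩ := ud_finite_aux Λ U hUopen hU0 huniq (tsupport f) hfc
    have hfin : ∀ x, (Function.support fun s : Λ => c s * f (x - s)).Finite := by
      intro x
      obtain ⟨T, -, hT⟩ := hN x
      refine (T.finite_toSet.preimage (Subtype.val_injective.injOn)).subset ?_
      intro s hs
      refine hT s s.2 ?_
      by_contra hn
      exact hs (by simp [hz _ hn])
    constructor
    · have : (fun x => ∑' s : Λ, c s * f (x - s)) = fun x => ∑ᶠ s : Λ, c s * f (x - s) := by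
        funext x
        exact tsum_eq_finsum (hfin x)
      rw [this]
      refine continuous_finsum (fun s => by fun_prop) ?_
      intro x0
      obtain ⟨W, hW, hWn⟩ := exists_compact_mem_nhds x0
      obtain ⟨M, hM⟩ := ud_finite_aux Λ U hUopen hU0 huniq (tsupport f - W) (by
        rw [sub_eq_add_neg]; exact IsCompact.add hfc hW.neg)
      obtain ⟨T, -, hT⟩ := hM 0
      refine ⟨W, hWn, (T.finite_toSet.preimage (Subtype.val_injective.injOn)).subset ?_⟩
      rintro s ⟨x, hx, hxW⟩
      refine hT s s.2 ⟨x - s, ?_, x, hxW, by simp⟩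
      by_contra hn
      exact hx (by simp [hz _ hn])
    · obtain ⟨B, hB⟩ := hf.bounded_above_of_compact_support hfc
      have hB0 : 0 ≤ B := (norm_nonneg _).trans (hB 0)
      rw [Metric.tendsto_nhds]
      intro ε hε
      set δ := ε / ((N + 1) * (B + 1)) with hδ
      have hδ0 : 0 < δ := by positivity
      obtain ⟨K, hK, hKs⟩ := h δ hδ0
      refine mem_cocompact.2 ⟨K + tsupport f, IsCompact.add hK hfc, fun x hx => ?_⟩
      obtain ⟨T, hTc, hT⟩ := hN x
      have hterm : ∀ s : Λ, ‖c s * f (x - s)‖ ≤ δ * B := by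
        intro s
        by_cases hs : x - s ∈ tsupport f
        · have : (s : G) ∉ K := fun hsK => hx ⟨s, hsK, x - s, hs, by simp⟩
          rw [norm_mul]
          exact mul_le_mul (hKs s ⟨s.2, this⟩).le (hB _) (norm_nonneg _) hδ0.le
        · rw [hz _ hs]; simp; positivity
      have hsum : ∑' s : Λ, c s * f (x - s) = ∑ s ∈ T.subtype (· ∈ Λ), c s * f (x - s) := by
        apply tsum_eq_sum
        intro s hs
        rw [hz, mul_zero]
        intro hn
        exact hs (Finset.mem_subtype.2 (hT s s.2 hn))
      have hcard : ((T.subtype (· ∈ Λ)).card : ℝ) ≤ N := by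
        rw [Finset.card_subtype]
        exact_mod_cast (Finset.card_filter_le _ _).trans hTc
      change dist (∑' s : Λ, c s * f (x - s)) 0 < ε
      rw [dist_zero_right, hsum]
      calc _ ≤ ∑ s ∈ T.subtype (· ∈ Λ), δ * B := norm_sum_le_of_le _ fun s _ => hterm s
        _ = (T.subtype (· ∈ Λ)).card * (δ * B) := by simp
        _ ≤ N * (δ * B) := by gcongr
        _ < (N + 1) * (δ * (B + 1)) := by
          have : (0 : ℝ) ≤ N := by positivity
          nlinarith [mul_nonneg this hδ0.le, mul_nonneg hδ0.le hB0]
        _ = ε := by rw [hδ]; field_simp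
end

section
/- A general construction of measures vanishing at infinity: let G be a σ-compact locally compact abelian Hausdorff group, K ⊆ G a compact set, and (a_n)_{n∈ℕ}, (b_n)_{n∈ℕ} finite positive Borel measures on G with support contained in K such that sup_n (a_n(G) + b_n(G)) < ∞ and, for every f ∈ C_c(G), ∫_G f da_n − ∫_G f db_n → 0 as n → ∞. Let (t_n)_{n∈ℕ} be pairwise distinct points of G such that the set {t_n : n ∈ ℕ} is uniformly discrete (there is an open neighborhood U of 0 with (t_m+U) ∩ (t_n+U) = ∅ for m ≠ n). Then for every f ∈ C_c(G), the function x ↦ Σ_{n=1}^∞ ( ∫_G f(x − t_n − s) da_n(s) − ∫_G f(x − t_n − s) db_n(s) ) is well defined and belongs to C₀(G). -/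
open MeasureTheory Filter Topology
open scoped NNReal ENNReal Pointwise


section Helpers
variable {G : Type*} [TopologicalSpace G] [AddCommGroup G] [IsTopologicalAddGroup G]

theorem aux_count (L : Set G) (hL : IsCompact L) (t : ℕ → G)
    (U : Set G) (hUopen : IsOpen U) (hU0 : (0 : G) ∈ U)
    (hdisj : ∀ m n : ℕ, m ≠ n → Disjoint (t m +ᵥ U) (t n +ᵥ U)) :
    ∃ N : ℕ, ∀ x : G, ∃ F : Finset ℕ, F.card ≤ N ∧ ∀ n, n ∉ F → x - t n ∉ L := by
  classical
  obtain ⟨S, hS, hcov⟩ := hL.elim_nhds_subcover (fun l => l +ᵥ U) (fun l _ => by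
    have : IsOpen (l +ᵥ U) := hUopen.vadd l
    exact this.mem_nhds ⟨0, hU0, by simp⟩)
  refine ⟨S.card, fun x => ?_⟩
  have key : ∀ n, x - t n ∈ L → ∃ l ∈ S, x - t n ∈ l +ᵥ U := by
    intro n hn
    simpa using hcov hn
  choose! φ hφS hφ using key
  have hinj : Set.InjOn φ {n | x - t n ∈ L} := by
    intro m hm n hn hmn
    by_contra hne
    obtain ⟨u, hu, hu'⟩ := hφ m hm
    obtain ⟨v, hv, hv'⟩ := hφ n hn
    simp only [vadd_eq_add] at hu' hv'
    have h1 : x - φ m ∈ t m +ᵥ U := by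
      refine ⟨u, hu, ?_⟩
      simp only [vadd_eq_add]
      rw [eq_sub_iff_add_eq, add_assoc, add_comm u, hu']; abel
    have h2 : x - φ m ∈ t n +ᵥ U := by
      refine ⟨v, hv, ?_⟩
      simp only [vadd_eq_add]
      rw [hmn, eq_sub_iff_add_eq, add_assoc, add_comm v, hv']; abel
    exact Set.disjoint_left.1 (hdisj m n hne) h1 h2
  have hfin : {n | x - t n ∈ L}.Finite :=
    Set.Finite.of_finite_image (S.finite_toSet.subset (by
      rintro _ ⟨n, hn, rfl⟩; exact hφS n hn)) hinj
  refine ⟨hfin.toFinset, Finset.card_le_card_of_injOn φ ?_ ?_, ?_⟩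
  · intro n hn
    exact hφS n (by simpa using hn)
  · simpa using hinj
  · intro n hn
    simpa using hn

theorem aux_abstract [T2Space G] (L : Set G) (hL : IsCompact L) (t : ℕ → G)
    (U : Set G) (hUopen : IsOpen U) (hU0 : (0 : G) ∈ U)
    (hdisj : ∀ m n : ℕ, m ≠ n → Disjoint (t m +ᵥ U) (t n +ᵥ U))
    (g : ℕ → G → ℂ) (hg : ∀ n, Continuous (g n)) (hgL : ∀ n y, y ∉ L → g n y = 0)
    (hunif : ∀ ε > 0, ∀ᶠ n in atTop, ∀ y, ‖g n y‖ ≤ ε) :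
    (∀ x, Summable (fun n => g n (x - t n))) ∧
    Continuous (fun x => ∑' n, g n (x - t n)) ∧
    Tendsto (fun x => ∑' n, g n (x - t n)) (cocompact G) (𝓝 0) := by
  classical
  obtain ⟨N, hN⟩ := aux_count L hL t U hUopen hU0 hdisj
  have hsum : ∀ x, Summable (fun n => g n (x - t n)) := by
    intro x
    obtain ⟨F, -, hF⟩ := hN x
    exact summable_of_ne_finset_zero (s := F) (fun n hn => hgL n _ (hF n hn))
  have hU : TendstoUniformly (fun (M : ℕ) x => ∑ n ∈ Finset.range M, g n (x - t n))
      (fun x => ∑' n, g n (x - t n)) atTop := by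
    rw [Metric.tendstoUniformly_iff]
    intro ε hε
    have hδ : 0 < ε / (N + 1) := by positivity
    obtain ⟨M0, hM0⟩ := eventually_atTop.1 (hunif _ hδ)
    filter_upwards [eventually_ge_atTop M0] with M hM x
    obtain ⟨F, hFc, hF⟩ := hN x
    have h1 : ∑' n, g n (x - t n) = ∑ n ∈ F ∪ Finset.range M, g n (x - t n) :=
      tsum_eq_sum (fun n hn => hgL n _ (hF n (fun h => hn (Finset.mem_union_left _ h))))
    rw [dist_eq_norm, h1, ← Finset.sum_sdiff (Finset.subset_union_right (s₁ := F)),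
      add_sub_cancel_right, Finset.union_sdiff_right]
    calc _ ≤ ∑ n ∈ F \ Finset.range M, ‖g n (x - t n)‖ := norm_sum_le _ _
      _ ≤ (F \ Finset.range M).card • (ε / (N + 1)) := by
        apply Finset.sum_le_card_nsmul
        intro n hn
        simp only [Finset.mem_sdiff, Finset.mem_range, not_lt] at hn
        exact hM0 n (hM.trans hn.2) _
      _ ≤ N * (ε / (N + 1)) := by
        rw [nsmul_eq_mul]
        gcongr
        exact (Finset.card_le_card Finset.sdiff_subset).trans hFc
      _ < ε := by
        rw [mul_div_assoc', div_lt_iff₀ (by positivity)]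
        nlinarith
  refine ⟨hsum, hU.continuous (Frequently.of_forall fun M => by fun_prop), ?_⟩
  rw [Metric.tendsto_nhds]
  intro ε hε
  obtain ⟨M, hM⟩ := ((Metric.tendstoUniformly_iff.1 hU) ε hε).exists
  have hz : ∀ n, ∀ᶠ x in cocompact G, x - t n ∉ L := by
    intro n
    have : Tendsto (fun x => x - t n) (cocompact G) (cocompact G) :=
      (Homeomorph.subRight (t n)).isClosedEmbedding.tendsto_cocompact
    exact this.eventually hL.compl_mem_cocompact
  have hz' : ∀ᶠ x in cocompact G, ∀ n ∈ Finset.range M, x - t n ∉ L :=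
    (Finset.eventually_all _).2 (fun n _ => hz n)
  filter_upwards [hz'] with x hx
  have := hM x
  rwa [Finset.sum_eq_zero (fun n hn => hgL n _ (hx n hn))] at this

end Helpers

/-- A general construction of measures vanishing at infinity: if `(a n)` and
`(b n)` are finite measures supported in a fixed compact set `K`, with
uniformly bounded total masses, such that `a n - b n → 0` vaguely, and
`(t n)` is a uniformly discrete sequence of distinct points, then the measure
`Σ_n T_{t n} (a n - b n)` vanishes at infinity. -/
theorem construction_of_measures_vanishing_at_infinity
    {G : Type*} [TopologicalSpace G] [AddCommGroup G] [IsTopologicalAddGroup G]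
    [LocallyCompactSpace G] [SigmaCompactSpace G] [T2Space G]
    [MeasurableSpace G] [BorelSpace G]
    (K : Set G) (hK : IsCompact K)
    (a b : ℕ → Measure G) [∀ n, IsFiniteMeasure (a n)] [∀ n, IsFiniteMeasure (b n)]
    (hsa : ∀ n, (a n) Kᶜ = 0) (hsb : ∀ n, (b n) Kᶜ = 0)
    (hbound : ∃ C : ℝ≥0, ∀ n, (a n) Set.univ + (b n) Set.univ ≤ (C : ℝ≥0∞))
    (hvague : ∀ f : G → ℂ, Continuous f → HasCompactSupport f →
      Tendsto (fun n => (∫ s, f s ∂(a n)) - ∫ s, f s ∂(b n)) atTop (𝓝 0))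
    (t : ℕ → G) (ht : Function.Injective t)
    (U : Set G) (hUopen : IsOpen U) (hU0 : (0 : G) ∈ U)
    (hdisj : ∀ m n : ℕ, m ≠ n → Disjoint (t m +ᵥ U) (t n +ᵥ U)) :
    ∀ f : G → ℂ, Continuous f → HasCompactSupport f →
      (∀ x : G, Summable (fun n : ℕ =>
          (∫ s, f (x - t n - s) ∂(a n)) - ∫ s, f (x - t n - s) ∂(b n))) ∧
      Continuous (fun x : G => ∑' n : ℕ,
          ((∫ s, f (x - t n - s) ∂(a n)) - ∫ s, f (x - t n - s) ∂(b n))) ∧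
      Tendsto (fun x : G => ∑' n : ℕ,
          ((∫ s, f (x - t n - s) ∂(a n)) - ∫ s, f (x - t n - s) ∂(b n)))
        (cocompact G) (𝓝 0) := by
  intro f hf hfc
  obtain ⟨C, hC⟩ := hbound
  have hcs : ∀ y, HasCompactSupport (fun s => f (y - s)) := fun y =>
    hfc.comp_homeomorph (Homeomorph.subLeft y)
  have hct : ∀ y, Continuous (fun s => f (y - s)) := fun y => by fun_prop
  have hia : ∀ n y, Integrable (fun s => f (y - s)) (a n) := fun n y =>
    (hct y).integrable_of_hasCompactSupport (hcs y)
  have hib : ∀ n y, Integrable (fun s => f (y - s)) (b n) := fun n y =>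
    (hct y).integrable_of_hasCompactSupport (hcs y)
  have hKa : ∀ n, ∀ᵐ s ∂(a n), s ∈ K := fun n => hsa n
  have hKb : ∀ n, ∀ᵐ s ∂(b n), s ∈ K := fun n => hsb n
  have hCr : ∀ n, (a n).real Set.univ + (b n).real Set.univ ≤ C := by
    intro n
    rw [Measure.real, Measure.real, ← ENNReal.toReal_add (measure_ne_top _ _) (measure_ne_top _ _)]
    exact ENNReal.toReal_le_coe_of_le_coe (hC n)
  set g : ℕ → G → ℂ := fun n y => (∫ s, f (y - s) ∂(a n)) - ∫ s, f (y - s) ∂(b n) with hgdef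
  have hequi : ∀ y0, ∀ ε > 0, ∀ᶠ y in 𝓝 y0, ∀ n, ‖g n y - g n y0‖ ≤ ε := by
    intro y0 ε hε
    have hδ : 0 < ε / (C + 1) := by positivity
    have h1 : ∀ᶠ y in 𝓝 y0, ∀ s ∈ K, ‖f (y - s) - f (y0 - s)‖ < ε / (C + 1) := by
      apply hK.eventually_forall_of_forall_eventually
      intro s _
      have hc : Continuous (fun z : G × G => ‖f (z.1 - z.2) - f (y0 - z.2)‖) := by fun_prop
      exact hc.continuousAt.eventually_lt continuousAt_const (by simpa using hδ)
    filter_upwards [h1] with y hy n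
    have ea : ‖∫ s, (f (y - s) - f (y0 - s)) ∂(a n)‖ ≤ ε / (C + 1) * (a n).real Set.univ :=
      norm_integral_le_of_norm_le_const ((hKa n).mono fun s hs => (hy s hs).le)
    have eb : ‖∫ s, (f (y - s) - f (y0 - s)) ∂(b n)‖ ≤ ε / (C + 1) * (b n).real Set.univ :=
      norm_integral_le_of_norm_le_const ((hKb n).mono fun s hs => (hy s hs).le)
    have e : g n y - g n y0 = (∫ s, (f (y - s) - f (y0 - s)) ∂(a n))
        - ∫ s, (f (y - s) - f (y0 - s)) ∂(b n) := by
      rw [integral_sub (hia n y) (hia n y0), integral_sub (hib n y) (hib n y0)]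
      simp only [hgdef]; ring
    rw [e]
    calc _ ≤ _ := norm_sub_le _ _
      _ ≤ ε / (C + 1) * ((a n).real Set.univ + (b n).real Set.univ) := by
        rw [mul_add]; exact add_le_add ea eb
      _ ≤ ε / (C + 1) * (C + 1) := by
        exact mul_le_mul_of_nonneg_left ((hCr n).trans (by linarith)) hδ.le
      _ = ε := by field_simp
  have hgc : ∀ n, Continuous (g n) := by
    intro n
    rw [continuous_iff_continuousAt]
    intro y0
    rw [ContinuousAt, Metric.tendsto_nhds]
    intro ε hε
    filter_upwards [hequi y0 (ε / 2) (by positivity)] with y hy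
    rw [dist_eq_norm]
    exact (hy n).trans_lt (by linarith)
  have hL : IsCompact (tsupport f + K) := IsCompact.add hfc hK
  have hgL : ∀ n y, y ∉ tsupport f + K → g n y = 0 := by
    intro n y hy
    have hz : ∀ s ∈ K, f (y - s) = 0 := by
      intro s hs
      by_contra h
      exact hy ⟨y - s, subset_tsupport f h, s, hs, by simp⟩
    simp only [hgdef]
    rw [integral_eq_zero_of_ae ((hKa n).mono fun s hs => hz s hs),
      integral_eq_zero_of_ae ((hKb n).mono fun s hs => hz s hs), sub_zero]
  have hunif : ∀ ε > 0, ∀ᶠ n in atTop, ∀ y, ‖g n y‖ ≤ ε := by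
    intro ε hε
    obtain ⟨S, -, hcov⟩ := hL.elim_nhds_subcover
      (fun y0 => {y | ∀ n, ‖g n y - g n y0‖ ≤ ε / 2}) (fun y0 _ => hequi y0 _ (by positivity))
    have hpt : ∀ᶠ n in atTop, ∀ y0 ∈ S, ‖g n y0‖ < ε / 2 := by
      refine (Finset.eventually_all _).2 (fun y0 _ => ?_)
      have := (Metric.tendsto_nhds.1 (hvague _ (hct y0) (hcs y0))) (ε / 2) (by positivity)
      simpa only [dist_zero_right] using this
    filter_upwards [hpt] with n hn y
    by_cases hy : y ∈ tsupport f + K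
    · obtain ⟨y0, hy0, hyy⟩ : ∃ y0 ∈ S, ∀ n, ‖g n y - g n y0‖ ≤ ε / 2 := by
        simpa only [Set.mem_iUnion, exists_prop, Set.mem_ofPred_eq] using hcov hy
      have h2 := norm_add_le (g n y - g n y0) (g n y0)
      rw [sub_add_cancel] at h2
      linarith [hyy n, hn y0 hy0]
    · rw [hgL n y hy, norm_zero]; exact hε.le
  exact aux_abstract _ hL t U hUopen hU0 hdisj g hgc hgL hunif
end

section
/- Measures vanishing at infinity are translation bounded: let G be a σ-compact locally compact abelian Hausdorff group and let μ be a positive regular Borel measure on G, finite on compact sets, such that μ∗f ∈ C₀(G) for every f ∈ C_c(G). Then for every compact set K ⊆ G, sup_{x∈G} μ(x+K) < ∞. -/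
open MeasureTheory Filter Topology
open scoped NNReal Pointwise

/-- Measures vanishing at infinity are translation bounded: if `μ` is a
positive regular measure, finite on compacts, with `μ ∗ f ∈ C₀(G)` for every
`f ∈ C_c(G)`, then `sup_x μ (x + K) < ∞` for every compact `K`. -/
theorem vanishing_at_infinity_implies_translation_bounded
    {G : Type*} [TopologicalSpace G] [AddCommGroup G] [IsTopologicalAddGroup G]
    [LocallyCompactSpace G] [SigmaCompactSpace G] [T2Space G]
    [MeasurableSpace G] [BorelSpace G]
    (μ : Measure G) [μ.Regular] [IsFiniteMeasureOnCompacts μ]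
    (hvan : ∀ f : G → ℂ, Continuous f → HasCompactSupport f →
      Continuous (fun x => ∫ t, f (x - t) ∂μ) ∧
        Tendsto (fun x => ∫ t, f (x - t) ∂μ) (cocompact G) (𝓝 0)) :
    ∀ K : Set G, IsCompact K → ∃ C : ℝ≥0, ∀ x : G, μ (x +ᵥ K) ≤ C := by
  intro K hK
  obtain ⟨φ, hφ1, -, hφc, hφ01⟩ := exists_continuous_one_zero_of_isCompact hK.neg
    isClosed_empty (Set.disjoint_empty _)
  have hcont : Continuous (fun x => ((φ x : ℝ) : ℂ)) := by fun_prop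
  have hsupp : HasCompactSupport (fun x => ((φ x : ℝ) : ℂ)) :=
    hφc.comp_left (g := fun r : ℝ => (r : ℂ)) (by simp)
  obtain ⟨hc, ht⟩ := hvan _ hcont hsupp
  let F : ZeroAtInftyContinuousMap G ℂ := ⟨⟨_, hc⟩, ht⟩
  refine ⟨‖F.toBCF‖₊, fun x => ?_⟩
  have hb : ‖∫ t, ((φ (x - t) : ℝ) : ℂ) ∂μ‖ ≤ ‖F.toBCF‖ := F.toBCF.norm_coe_le_norm x
  have hgc : Continuous (fun t => φ (x - t)) := by fun_prop
  have hgs : HasCompactSupport (fun t => φ (x - t)) :=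
    hφc.comp_homeomorph (Homeomorph.subLeft x)
  have hgi : Integrable (fun t => φ (x - t)) μ := hgc.integrable_of_hasCompactSupport hgs
  have h0 : 0 ≤ ∫ t, φ (x - t) ∂μ := integral_nonneg fun t => (hφ01 _).1
  rw [integral_complex_ofReal, Complex.norm_real, Real.norm_of_nonneg h0] at hb
  have hxK : MeasurableSet (x +ᵥ K) := (hK.vadd x).measurableSet
  calc μ (x +ᵥ K) = ∫⁻ t in x +ᵥ K, 1 ∂μ := by simp
    _ ≤ ∫⁻ t in x +ᵥ K, ENNReal.ofReal (φ (x - t)) ∂μ := by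
        refine setLIntegral_mono' hxK fun t htK => ?_
        obtain ⟨k, hk, rfl⟩ := htK
        have : φ (x - (x +ᵥ k)) = 1 := hφ1 (by simpa using hk)
        simp only [this, ENNReal.ofReal_one, le_refl]
    _ ≤ ∫⁻ t, ENNReal.ofReal (φ (x - t)) ∂μ := setLIntegral_le_lintegral _ _
    _ = ENNReal.ofReal (∫ t, φ (x - t) ∂μ) :=
        (ofReal_integral_eq_lintegral_ofReal hgi (ae_of_all _ fun t => (hφ01 _).1)).symm
    _ ≤ ENNReal.ofReal ‖F.toBCF‖ := ENNReal.ofReal_le_ofReal hb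
    _ = _ := by rw [ofReal_norm, enorm_eq_nnnorm]
end

section
/- The Fourier transform of the arc-length measure on the unit circle vanishes at infinity: let σ denote the arc-length (one-dimensional Hausdorff) measure on the unit circle S¹ ⊆ ℝ². Then the function F : ℝ² → ℂ defined by F(x) = ∫_{S¹} e^{−2πi⟨x,ω⟩} dσ(ω) is continuous and belongs to C₀(ℝ²); consequently the absolutely continuous measure F·λ² on ℝ² vanishes at infinity (its convolution with every f ∈ C_c(ℝ²) lies in C₀(ℝ²)), even though it is the Fourier transform of the singular measure σ. -/
open MeasureTheory Filter Topology Real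

lemma circ_lip (e : ℝ) (he : e ^ 2 = 1) :
    LipschitzWith 2 (fun θ : ℝ => (!₂[cos θ, e * sin θ] : EuclideanSpace ℝ (Fin 2))) := by
  refine LipschitzWith.of_dist_le_mul fun a b => ?_
  have h1 : |cos a - cos b| ≤ |a - b| := by
    simpa [Real.dist_eq] using Real.lipschitzWith_cos.dist_le_mul a b
  have h2 : |sin a - sin b| ≤ |a - b| := by
    simpa [Real.dist_eq] using Real.lipschitzWith_sin.dist_le_mul a b
  rw [EuclideanSpace.dist_eq]
  refine Real.sqrt_le_iff.2 ⟨by positivity, ?_⟩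
  simp only [Fin.sum_univ_two, Real.dist_eq, sq_abs, mul_pow]
  have h3 := sq_le_sq.2 h1
  have h4 := sq_le_sq.2 h2
  simp only [Matrix.cons_val_zero, Matrix.cons_val_one, NNReal.coe_ofNat]
  have : (e * sin a - e * sin b) ^ 2 = (sin a - sin b) ^ 2 := by
    rw [← mul_sub, mul_pow, he, one_mul]
  rw [this]
  nlinarith [sq_nonneg (a - b)]

lemma circ_cover (N : Set ℝ) :
    Metric.sphere (0 : EuclideanSpace ℝ (Fin 2)) 1 ∩ (fun ω => ω 0) ⁻¹' N ⊆
      (fun θ : ℝ => (!₂[cos θ, 1 * sin θ] : EuclideanSpace ℝ (Fin 2))) '' (arccos '' N) ∪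
      (fun θ : ℝ => (!₂[cos θ, (-1) * sin θ] : EuclideanSpace ℝ (Fin 2))) '' (arccos '' N) := by
  rintro ω ⟨hω, hN⟩
  have hs : ω 0 ^ 2 + ω 1 ^ 2 = 1 := by
    have : ‖ω‖ = 1 := by simpa using hω
    have h2 := EuclideanSpace.real_norm_sq_eq ω
    rw [this, Fin.sum_univ_two] at h2
    linarith
  have hc : cos (arccos (ω 0)) = ω 0 :=
    Real.cos_arccos (by nlinarith [sq_nonneg (ω 1)]) (by nlinarith [sq_nonneg (ω 1)])
  have hsn : sin (arccos (ω 0)) = |ω 1| := by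
    rw [Real.sin_arccos, ← Real.sqrt_sq_eq_abs]
    congr 1; linarith
  rcases le_total 0 (ω 1) with h | h
  · left
    refine ⟨_, ⟨_, hN, rfl⟩, ?_⟩
    ext i
    fin_cases i
    · simpa using hc
    · simp [hsn, abs_of_nonneg h]
  · right
    refine ⟨_, ⟨_, hN, rfl⟩, ?_⟩
    ext i
    fin_cases i
    · simpa using hc
    · simp [hsn, abs_of_nonpos h]

lemma circ_le (N : Set ℝ) :
    (μH[1] : Measure (EuclideanSpace ℝ (Fin 2)))
      (Metric.sphere (0 : EuclideanSpace ℝ (Fin 2)) 1 ∩ (fun ω => ω 0) ⁻¹' N) ≤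
      2 * volume (arccos '' N) + 2 * volume (arccos '' N) := by
  refine (measure_mono (circ_cover N)).trans ((measure_union_le _ _).trans ?_)
  have h1 := (circ_lip 1 (by norm_num)).hausdorffMeasure_image_le zero_le_one (arccos '' N)
  have h2 := (circ_lip (-1) (by norm_num)).hausdorffMeasure_image_le zero_le_one (arccos '' N)
  rw [hausdorffMeasure_real] at h1 h2
  simp only [ENNReal.rpow_one] at h1 h2
  exact add_le_add h1 h2

lemma circ_finite :
    (μH[1] : Measure (EuclideanSpace ℝ (Fin 2)))
      (Metric.sphere (0 : EuclideanSpace ℝ (Fin 2)) 1) < ⊤ := by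
  have h := circ_le Set.univ
  rw [Set.preimage_univ, Set.inter_univ] at h
  have h2 : volume (arccos '' Set.univ) < ⊤ := by
    refine (measure_mono (t := Set.Icc 0 π) ?_).trans_lt (by simp)
    rintro _ ⟨x, -, rfl⟩
    exact ⟨arccos_nonneg x, arccos_le_pi x⟩
  refine h.trans_lt ?_
  have := ENNReal.mul_lt_top (a := 2) (by simp) h2
  exact ENNReal.add_lt_top.2 ⟨this, this⟩

lemma arccos_null (N : Set ℝ) (hN : volume N = 0) : volume (arccos '' N) = 0 := by
  have h1 : volume (arccos '' (N ∩ {-1, 1}ᶜ)) = 0 :=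
    addHaar_image_eq_zero_of_differentiableOn_of_addHaar_eq_zero _
      (differentiableOn_arccos.mono Set.inter_subset_right)
      (measure_mono_null Set.inter_subset_left hN)
  have h2 : volume (arccos '' ({-1, 1} : Set ℝ)) = 0 :=
    ((Set.toFinite _).image _).measure_zero _
  refine measure_mono_null (t := arccos '' (N ∩ {-1, 1}ᶜ) ∪ arccos '' ({-1, 1} : Set ℝ)) ?_
    (measure_union_null h1 h2)
  rw [← Set.image_union]
  refine Set.image_mono fun x hx => ?_
  by_cases h : x ∈ ({-1, 1} : Set ℝ)
  · exact Or.inr h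
  · exact Or.inl ⟨hx, h⟩

lemma circ_ac :
    (((μH[1] : Measure (EuclideanSpace ℝ (Fin 2))).restrict
      (Metric.sphere (0 : EuclideanSpace ℝ (Fin 2)) 1)).map (fun ω => ω 0)) ≪ volume := by
  refine Measure.AbsolutelyContinuous.mk fun N hm hN => ?_
  have hmeas : Measurable (fun ω : EuclideanSpace ℝ (Fin 2) => ω 0) := by fun_prop
  rw [Measure.map_apply hmeas hm, Measure.restrict_apply (hmeas hm), Set.inter_comm]
  have := circ_le N
  rw [arccos_null N hN] at this
  simpa using this

lemma circ_radial (x y : EuclideanSpace ℝ (Fin 2)) (h : ‖x‖ = ‖y‖) :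
    ∫ ω in Metric.sphere (0 : EuclideanSpace ℝ (Fin 2)) 1,
        Complex.exp (-(2 * π * Complex.I * ((inner ℝ x ω : ℝ) : ℂ))) ∂(μH[1]) =
    ∫ ω in Metric.sphere (0 : EuclideanSpace ℝ (Fin 2)) 1,
        Complex.exp (-(2 * π * Complex.I * ((inner ℝ y ω : ℝ) : ℂ))) ∂(μH[1]) := by
  obtain ⟨R, hR⟩ : ∃ R : EuclideanSpace ℝ (Fin 2) ≃ₗᵢ[ℝ] EuclideanSpace ℝ (Fin 2), R x = y :=
    ⟨_, Submodule.reflection_sub h⟩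
  have := (R.toIsometryEquiv.measurePreserving_hausdorffMeasure 1).setIntegral_preimage_emb
    R.toIsometryEquiv.toHomeomorph.measurableEmbedding
    (fun ω => Complex.exp (-(2 * π * Complex.I * ((inner ℝ y ω : ℝ) : ℂ))))
    (Metric.sphere (0 : EuclideanSpace ℝ (Fin 2)) 1)
  rw [← this]
  have hp : R.toIsometryEquiv ⁻¹' (Metric.sphere (0 : EuclideanSpace ℝ (Fin 2)) 1) =
      Metric.sphere (0 : EuclideanSpace ℝ (Fin 2)) 1 := by
    ext ω; simp
  rw [hp]
  have hi : ∀ ω, inner ℝ y (R.toIsometryEquiv ω) = inner ℝ x ω := by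
    intro ω
    rw [← hR]
    exact R.inner_map_map x ω
  simp_rw [hi]

lemma circ_axis :
    Tendsto (fun r : ℝ => ∫ ω in Metric.sphere (0 : EuclideanSpace ℝ (Fin 2)) 1,
        Complex.exp (-(2 * π * Complex.I *
          ((inner ℝ (EuclideanSpace.single 0 r) ω : ℝ) : ℂ))) ∂(μH[1]))
      (cocompact ℝ) (𝓝 0) := by
  have hfin : IsFiniteMeasure ((μH[1] : Measure (EuclideanSpace ℝ (Fin 2))).restrict
      (Metric.sphere (0 : EuclideanSpace ℝ (Fin 2)) 1)) := ⟨by simpa using circ_finite⟩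
  set ν := (((μH[1] : Measure (EuclideanSpace ℝ (Fin 2))).restrict
      (Metric.sphere (0 : EuclideanSpace ℝ (Fin 2)) 1)).map (fun ω => ω 0)) with hν
  have key := Real.tendsto_integral_exp_smul_cocompact
    (fun s : ℝ => (((ν.rnDeriv volume s).toReal : ℝ) : ℂ))
  refine key.congr fun r => ?_
  have hmeas : Measurable (fun ω : EuclideanSpace ℝ (Fin 2) => ω 0) := by fun_prop
  have h1 := integral_rnDeriv_smul (μ := ν) (ν := volume) circ_ac
    (f := fun s : ℝ => Complex.exp (-(2 * π * Complex.I * ((s * r : ℝ) : ℂ))))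
  rw [hν, integral_map hmeas.aemeasurable (by fun_prop), ← hν] at h1
  have h2 : ∀ ω : EuclideanSpace ℝ (Fin 2),
      inner ℝ (EuclideanSpace.single 0 r) ω = ω 0 * r := by
    intro ω
    simp [EuclideanSpace.inner_single_left, mul_comm]
  simp_rw [h2]
  rw [← h1]
  refine integral_congr_ae (Eventually.of_forall fun s => ?_)
  simp only [Circle.smul_def, Real.fourierChar_apply, smul_eq_mul, Complex.real_smul]
  rw [mul_comm]
  congr 2; push_cast; ring



/-- The Fourier transform of the arc-length measure `σ` on the unit circle
`S¹ ⊆ ℝ²` vanishes at infinity: `F(x) = ∫_{S¹} e^{-2πi⟨x,ω⟩} dσ(ω)` is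
continuous and lies in `C₀(ℝ²)`, and consequently the absolutely continuous
measure `F·λ²` vanishes at infinity, even though it is the Fourier transform
of the singular measure `σ`. -/
theorem fourier_transform_of_circle_measure_vanishes_at_infinity
    (F : EuclideanSpace ℝ (Fin 2) → ℂ)
    (hF : ∀ x : EuclideanSpace ℝ (Fin 2),
      F x = ∫ ω in Metric.sphere (0 : EuclideanSpace ℝ (Fin 2)) 1,
        Complex.exp (-(2 * π * Complex.I * ((inner ℝ x ω : ℝ) : ℂ))) ∂(μH[1])) :
    Continuous F ∧
      Tendsto F (cocompact (EuclideanSpace ℝ (Fin 2))) (𝓝 0) ∧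
      (∀ f : EuclideanSpace ℝ (Fin 2) → ℂ, Continuous f → HasCompactSupport f →
        Continuous (fun x => ∫ t, F t * f (x - t)) ∧
          Tendsto (fun x => ∫ t, F t * f (x - t))
            (cocompact (EuclideanSpace ℝ (Fin 2))) (𝓝 0)) := by
  have hfin : IsFiniteMeasure ((μH[1] : Measure (EuclideanSpace ℝ (Fin 2))).restrict
      (Metric.sphere (0 : EuclideanSpace ℝ (Fin 2)) 1)) := ⟨by simpa using circ_finite⟩
  have hnorm : ∀ x ω : EuclideanSpace ℝ (Fin 2),
      ‖Complex.exp (-(2 * π * Complex.I * ((inner ℝ x ω : ℝ) : ℂ)))‖ = 1 := by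
    intro x ω
    rw [Complex.norm_exp]
    simp
  have hF' : F = fun x => ∫ ω in Metric.sphere (0 : EuclideanSpace ℝ (Fin 2)) 1,
        Complex.exp (-(2 * π * Complex.I * ((inner ℝ x ω : ℝ) : ℂ))) ∂(μH[1]) := funext hF
  have hcont : Continuous F := by
    rw [hF']
    refine continuous_of_dominated (bound := fun _ => 1) (fun x => ?_)
      (fun x => Eventually.of_forall fun ω => (hnorm x ω).le) (integrable_const _)
      (Eventually.of_forall fun ω => by fun_prop)
    exact Continuous.aestronglyMeasurable (by fun_prop)
  obtain ⟨C, hC⟩ : ∃ C : ℝ, ∀ x, ‖F x‖ ≤ C := by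
    refine ⟨1 * ((μH[1] : Measure (EuclideanSpace ℝ (Fin 2))).restrict
      (Metric.sphere (0 : EuclideanSpace ℝ (Fin 2)) 1)).real Set.univ, fun x => ?_⟩
    rw [hF]
    exact norm_integral_le_of_norm_le_const (Eventually.of_forall fun ω => (hnorm x ω).le)
  have hlim : Tendsto F (cocompact (EuclideanSpace ℝ (Fin 2))) (𝓝 0) := by
    have h1 : Tendsto (fun x : EuclideanSpace ℝ (Fin 2) => ‖x‖)
        (cocompact (EuclideanSpace ℝ (Fin 2))) (cocompact ℝ) :=
      tendsto_norm_cocompact_atTop.mono_right atTop_le_cocompact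
    refine (circ_axis.comp h1).congr fun x => ?_
    rw [hF]
    exact circ_radial _ _ (by simp)
  refine ⟨hcont, hlim, fun f hf hfc => ?_⟩
  have hconv : (fun x => ∫ t, F t * f (x - t)) = fun x => ∫ t, F (x - t) * f t := by
    funext x
    rw [← integral_sub_left_eq_self (fun t => F t * f (x - t)) volume x]
    simp
  rw [hconv]
  have hint : Integrable (fun t => C * ‖f t‖) :=
    (hf.integrable_of_hasCompactSupport hfc).norm.const_mul C
  have hb : ∀ x t, ‖F (x - t) * f t‖ ≤ C * ‖f t‖ := fun x t => by
    rw [norm_mul]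
    exact mul_le_mul_of_nonneg_right (hC _) (norm_nonneg _)
  have hm : ∀ x, AEStronglyMeasurable (fun t => F (x - t) * f t) volume := fun x =>
    Continuous.aestronglyMeasurable (by fun_prop)
  refine ⟨continuous_of_dominated hm (fun x => Eventually.of_forall (hb x)) hint
    (Eventually.of_forall fun t => by fun_prop), ?_⟩
  have hcg : (cocompact (EuclideanSpace ℝ (Fin 2))).IsCountablyGenerated := by
    rw [← Metric.cobounded_eq_cocompact, ← comap_norm_atTop]
    infer_instance
  have := tendsto_integral_filter_of_dominated_convergence (μ := volume)
    (l := cocompact (EuclideanSpace ℝ (Fin 2))) (F := fun x t => F (x - t) * f t)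
    (f := fun _ => 0) _ (Eventually.of_forall hm)
    (Eventually.of_forall fun x => Eventually.of_forall (hb x)) hint
    (Eventually.of_forall fun t => by
      have h := (hlim.comp (Homeomorph.subRight t).isClosedEmbedding.tendsto_cocompact).mul_const
        (f t)
      simpa using h)
  simpa using this
end
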